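/- There is no set S of positive integers with 1 ∈ S whose density H(S) lies in the open interval (∏_p (1 − (p−1)/p³), ∏_p (1 − 1/p³)), where both products run over all primes p. -/

import Mathlib

open scoped Classical

/-- `charFn S` is the characteristic function `u` of a set `S` of positive integers. -/
noncomputable def charFn (S : Set ℕ) (n : ℕ) : ℝ := if n ∈ S then 1 else 0

/-- `H S = ∏_p (1 + Σ_{i ≥ 2} (u(i) - u(i-1)) / p^i)`, the product over all primes. -/
noncomputable def H (S : Set ℕ) : ℝ :=
  ∏' p : Nat.Primes,
    (1 + ∑' i : ℕ, (charFn S (i + 2) - charFn S (i + 1)) / ((p : ℕ) : ℝ) ^ (i + 2))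

/-- The exponentially `S`-numbers: positive integers all of whose prime-factorization
exponents lie in `S`. -/
def ExpS (S : Set ℕ) : Set ℕ :=
  {N | 0 < N ∧ ∀ p : ℕ, p.Prime → p ∣ N → N.factorization p ∈ S}

/-- The set `D` of all densities `H S` as `S` ranges over sets of positive integers
containing `1`. -/
noncomputable def densitySet : Set ℝ :=
  {x | ∃ S : Set ℕ, 1 ∈ S ∧ (∀ n ∈ S, 0 < n) ∧ H S = x}

lemma charFn_nonneg (S : Set ℕ) (n : ℕ) : 0 ≤ charFn S n := by
  unfold charFn; split_ifs <;> norm_num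

lemma charFn_le_one (S : Set ℕ) (n : ℕ) : charFn S n ≤ 1 := by
  unfold charFn; split_ifs <;> norm_num

lemma summable_charFn_mul_pow (S : Set ℕ) {x : ℝ} (h0 : 0 ≤ x) (hx : x < 1) (k : ℕ) :
    Summable fun i : ℕ => charFn S (i + k) * x ^ (i + k) :=
  Summable.of_nonneg_of_le (fun i => mul_nonneg (charFn_nonneg S _) (by positivity))
    (fun i => mul_le_of_le_one_left (by positivity) (charFn_le_one S _))
    ((summable_nat_add_iff k).2 (summable_geometric_of_lt_one h0 hx))

lemma tsum_charFn_mul_pow_nonneg (S : Set ℕ) {x : ℝ} (h0 : 0 ≤ x) (k : ℕ) :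
    0 ≤ ∑' i : ℕ, charFn S (i + k) * x ^ (i + k) :=
  tsum_nonneg fun i => mul_nonneg (charFn_nonneg S _) (by positivity)

lemma one_sub_mul_tsum_charFn_le (S : Set ℕ) {x : ℝ} (h0 : 0 ≤ x) (hx : x < 1) (k : ℕ) :
    (1 - x) * ∑' i : ℕ, charFn S (i + k) * x ^ (i + k) ≤ x ^ k := by
  have hle : ∑' i : ℕ, charFn S (i + k) * x ^ (i + k) ≤ ∑' i : ℕ, x ^ (i + k) :=
    (summable_charFn_mul_pow S h0 hx k).tsum_le_tsum
      (fun i => mul_le_of_le_one_left (by positivity) (charFn_le_one S _))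
      ((summable_nat_add_iff k).2 (summable_geometric_of_lt_one h0 hx))
  have hx' : 0 < 1 - x := by linarith
  simp_rw [pow_add] at hle ⊢
  rw [tsum_mul_right, tsum_geometric_of_lt_one h0 hx] at hle
  calc _ ≤ (1 - x) * ((1 - x)⁻¹ * x ^ k) := mul_le_mul_of_nonneg_left hle hx'.le
    _ = x ^ k := by field_simp

lemma tsum_charFn_mul_pow_succ (S : Set ℕ) {x : ℝ} (h0 : 0 ≤ x) (hx : x < 1) (k : ℕ) :
    ∑' i : ℕ, charFn S (i + k) * x ^ (i + k) =
      charFn S k * x ^ k + ∑' i : ℕ, charFn S (i + (k + 1)) * x ^ (i + (k + 1)) := by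
  rw [(summable_charFn_mul_pow S h0 hx k).tsum_eq_zero_add]
  simp only [zero_add, add_right_comm _ 1 k, add_assoc _ k 1]

/-- Summation by parts in the Euler factor of `H S`. -/
lemma tsum_charFn_sub_div (S : Set ℕ) (h1 : 1 ∈ S) {y : ℝ} (hy : 1 < y) :
    ∑' i : ℕ, (charFn S (i + 2) - charFn S (i + 1)) / y ^ (i + 2) =
      (1 - y⁻¹) * (∑' i : ℕ, charFn S (i + 2) * y⁻¹ ^ (i + 2)) - y⁻¹ ^ 2 := by
  have h0 : 0 ≤ y⁻¹ := by positivity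
  have hx : y⁻¹ < 1 := inv_lt_one_of_one_lt₀ hy
  have hterm : ∀ i : ℕ, (charFn S (i + 2) - charFn S (i + 1)) / y ^ (i + 2) =
      charFn S (i + 2) * y⁻¹ ^ (i + 2) - y⁻¹ * (charFn S (i + 1) * y⁻¹ ^ (i + 1)) := by
    intro i
    rw [div_eq_mul_inv, ← inv_pow]
    ring
  have hone : charFn S 1 = 1 := by simp [charFn, h1]
  simp_rw [hterm]
  rw [(summable_charFn_mul_pow S h0 hx 2).tsum_sub
    ((summable_charFn_mul_pow S h0 hx 1).mul_left _), tsum_mul_left,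
    tsum_charFn_mul_pow_succ S h0 hx 1, hone]
  ring

lemma multipliable_primes_one_add {f : ℕ → ℝ}
    (hf : ∀ p : Nat.Primes, |f p| ≤ ((p : ℕ) : ℝ)⁻¹ ^ 2) :
    Multipliable fun p : Nat.Primes => 1 + f p := by
  apply multipliable_one_add_of_summable
  have hs : Summable fun n : ℕ => (n : ℝ)⁻¹ ^ 2 := by
    simpa only [inv_pow] using Real.summable_nat_pow_inv.2 one_lt_two
  exact Summable.of_nonneg_of_le (fun _ => norm_nonneg _) hf
    (hs.comp_injective (i := fun p : Nat.Primes => (p : ℕ)) Subtype.val_injective)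

lemma tprod_le_tprod_of_nonneg {ι : Type*} {f g : ι → ℝ} (hf : Multipliable f)
    (hg : Multipliable g) (h0 : ∀ i, 0 ≤ f i) (hfg : ∀ i, f i ≤ g i) :
    ∏' i, f i ≤ ∏' i, g i :=
  le_of_tendsto_of_tendsto' hf.hasProd hg.hasProd fun _ =>
    Finset.prod_le_prod (fun i _ => h0 i) fun i _ => hfg i

theorem berend_gap (S : Set ℕ) (h1 : 1 ∈ S) (hpos : ∀ n ∈ S, 0 < n) :
    H S ∉ Set.Ioo
      (∏' p : Nat.Primes, (1 - (((p : ℕ) : ℝ) - 1) / ((p : ℕ) : ℝ) ^ 3))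
      (∏' p : Nat.Primes, (1 - 1 / ((p : ℕ) : ℝ) ^ 3)) := by
  have hp1 : ∀ p : Nat.Primes, (1 : ℝ) < (p : ℕ) := fun p => by exact_mod_cast p.2.one_lt
  have hx0 : ∀ p : Nat.Primes, (0 : ℝ) ≤ ((p : ℕ) : ℝ)⁻¹ := fun p => by positivity
  have hx1 : ∀ p : Nat.Primes, ((p : ℕ) : ℝ)⁻¹ < 1 := fun p => inv_lt_one_of_one_lt₀ (hp1 p)
  have hxx : ∀ p : Nat.Primes, ((p : ℕ) : ℝ)⁻¹ ^ 3 ≤ ((p : ℕ) : ℝ)⁻¹ ^ 2 := fun p =>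
    pow_le_pow_of_le_one (hx0 p) (hx1 p).le (by norm_num)
  have hx3 : ∀ p : Nat.Primes, 0 ≤ ((p : ℕ) : ℝ)⁻¹ ^ 3 := fun p => pow_nonneg (hx0 p) 3
  have hx2 : ∀ p : Nat.Primes, ((p : ℕ) : ℝ)⁻¹ ^ 2 ≤ 1 := fun p =>
    pow_le_one₀ (hx0 p) (hx1 p).le
  have hnn : ∀ p : Nat.Primes,
      0 ≤ (1 - ((p : ℕ) : ℝ)⁻¹) * ∑' i : ℕ, charFn S (i + 2) * ((p : ℕ) : ℝ)⁻¹ ^ (i + 2) :=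
    fun p => mul_nonneg (by linarith [hx1 p]) (tsum_charFn_mul_pow_nonneg S (hx0 p) 2)
  have hH : Multipliable fun p : Nat.Primes =>
      1 + ∑' i : ℕ, (charFn S (i + 2) - charFn S (i + 1)) / ((p : ℕ) : ℝ) ^ (i + 2) := by
    refine multipliable_primes_one_add
      (f := fun n => ∑' i : ℕ, (charFn S (i + 2) - charFn S (i + 1)) / (n : ℝ) ^ (i + 2))
      fun p => ?_
    rw [tsum_charFn_sub_div S h1 (hp1 p), abs_le]
    constructor <;>
      linarith [hnn p, one_sub_mul_tsum_charFn_le S (hx0 p) (hx1 p) 2, sq_nonneg ((p : ℕ) : ℝ)⁻¹]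
  rintro ⟨hlo, hhi⟩
  by_cases h2 : 2 ∈ S
  · refine hhi.not_ge (tprod_le_tprod_of_nonneg ?_ hH (fun p => ?_) fun p => ?_)
    · simp_rw [sub_eq_add_neg]
      refine multipliable_primes_one_add (f := fun n => -(1 / (n : ℝ) ^ 3)) fun p => ?_
      rw [abs_neg, one_div, ← inv_pow, abs_of_nonneg (hx3 p)]
      exact hxx p
    · rw [one_div, ← inv_pow]
      linarith [hxx p, hx2 p]
    · have htwo : charFn S 2 = 1 := by simp [charFn, h2]
      rw [tsum_charFn_sub_div S h1 (hp1 p), tsum_charFn_mul_pow_succ S (hx0 p) (hx1 p), htwo,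
        one_div, ← inv_pow]
      have := mul_nonneg (sub_nonneg.2 (hx1 p).le) (tsum_charFn_mul_pow_nonneg S (hx0 p) (2 + 1))
      linarith
  · have heq : ∀ p : Nat.Primes, (((p : ℕ) : ℝ) - 1) / ((p : ℕ) : ℝ) ^ 3 =
        ((p : ℕ) : ℝ)⁻¹ ^ 2 - ((p : ℕ) : ℝ)⁻¹ ^ 3 := fun p => by
      have := (zero_lt_one.trans (hp1 p)).ne'
      field_simp
    refine hlo.not_ge (tprod_le_tprod_of_nonneg hH ?_ (fun p => ?_) fun p => ?_)
    · simp_rw [sub_eq_add_neg (1 : ℝ)]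
      refine multipliable_primes_one_add (f := fun n => -(((n : ℝ) - 1) / (n : ℝ) ^ 3))
        fun p => ?_
      rw [abs_neg, heq, abs_of_nonneg (by linarith [hxx p])]
      linarith [hx3 p]
    · rw [tsum_charFn_sub_div S h1 (hp1 p)]
      linarith [hnn p, hx2 p]
    · have htwo : charFn S 2 = 0 := by simp [charFn, h2]
      rw [heq, tsum_charFn_sub_div S h1 (hp1 p), tsum_charFn_mul_pow_succ S (hx0 p) (hx1 p), htwo,
        zero_mul, zero_add]
      linarith [one_sub_mul_tsum_charFn_le S (hx0 p) (hx1 p) (2 + 1)]
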